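/- Let α ≥ 1 and n ≥ 0 be integers, and let A be the (n+1)×(n+1) matrix with rational entries A_{j,m} = 1/F_{α+j+m} for 0 ≤ j, m ≤ n. Then A is invertible and its inverse has (j,m) entry equal to (−1)^{(α+j+m)n − binom(j,2) − binom(m,2)} · F_{α+j+m} · [α+n+j choose n−m]_F · [α+n+m choose n−j]_F · [α+j+m−1 choose j]_F · [α+j+m−1 choose m]_F. -/

import Mathlib

/-- The generalized fibonomial coefficient `[n choose j]_F` as a rational number:
`(F n * F (n-1) * ⋯ * F (n-j+1)) / (F 1 * F 2 * ⋯ * F j)`, with value `1` for `j = 0`. -/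
def fibin (F : ℤ → ℤ) (n : ℤ) (j : ℕ) : ℚ :=
  (∏ i ∈ Finset.range j, (F (n - i) : ℚ)) / ∏ i ∈ Finset.range j, (F ((i : ℤ) + 1) : ℚ)

namespace HankelFib

open Finset

/-- Recurrence for the rational-valued sequence. -/
def Rec (k : ℚ) (G : ℤ → ℚ) : Prop := ∀ n : ℤ, G (n + 1) = k * G n + G (n - 1)

lemma Rec.zero {k : ℚ} {H : ℤ → ℚ} (h : Rec k H) (h0 : H 0 = 0) (h1 : H 1 = 0) (a : ℤ) :
    H a = 0 := by
  have key : H a = 0 ∧ H (a + 1) = 0 := by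
    induction a using Int.induction_on with
    | zero => exact ⟨h0, by simpa using h1⟩
    | succ i ih =>
      refine ⟨ih.2, ?_⟩
      rw [h, ih.2, add_sub_cancel_right, ih.1]; simp
    | pred i ih =>
      have := h (-(i : ℤ))
      rw [ih.1, ih.2] at this
      refine ⟨by linarith, ?_⟩
      simpa using ih.1
  exact key.1

lemma G_add {k : ℚ} {G : ℤ → ℚ} (h : Rec k G) (h0 : G 0 = 0) (h1 : G 1 = 1) (a b : ℤ) :
    G (a + b) = G (a + 1) * G b + G a * G (b - 1) := by
  have hr : Rec k (fun a => G (a + b) - (G (a + 1) * G b + G a * G (b - 1))) := by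
    intro n
    have e1 := h (n + b)
    have e2 := h (n + 1)
    have e3 := h n
    have t1 : n + 1 + b = n + b + 1 := by ring
    have t2 : n - 1 + b = n + b - 1 := by ring
    have t3 : n - 1 + 1 = n := by ring
    have t4 : n + 1 - 1 = n := by ring
    simp only [t1, t2, t3]
    rw [t4] at e2
    rw [e1, e2]
    rw [e3]; ring
  have := hr.zero (by simp [h0, h1]) ?_ a
  · linarith
  · have e2 := h 1
    have e3 := h b
    simp only [h1]
    rw [e2, add_comm 1 b, e3]
    simp [h0, h1]

lemma G_neg {k : ℚ} {G : ℤ → ℚ} (h : Rec k G) (h0 : G 0 = 0) (h1 : G 1 = 1) (a : ℤ) :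
    G (-a) = (-1) ^ (a + 1) * G a := by
  have hr : Rec k (fun a => (-1) ^ (a + 1) * G (-a) - G a) := by
    intro n
    have e1 := h n
    have e2 := h (-n)
    have t1 : -(n + 1) = -n - 1 := by ring
    have t2 : -(n - 1) = -n + 1 := by ring
    have t3 : n - 1 + 1 = n := by ring
    simp only [t1, t2, t3]
    rw [e1, e2, zpow_add₀ (by norm_num), zpow_add₀ (by norm_num)]
    simp only [zpow_one]
    ring
  have := hr.zero (by simp [h0]) ?_ a
  · have hs : ((-1 : ℚ) ^ (a + 1)) * (-1) ^ (a + 1) = 1 := by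
      rw [← mul_zpow]; norm_num
    have h3 : G a = (-1) ^ (a + 1) * G (-a) := by linarith
    rw [h3, ← mul_assoc, hs, one_mul]
  · have e := h 0
    simp [h0, h1] at e ⊢
    rw [← e]
    norm_num [show (1 : ℤ) + 1 = ((2 : ℕ) : ℤ) by norm_num, zpow_natCast]

lemma G_docagne {k : ℚ} {G : ℤ → ℚ} (h : Rec k G) (h0 : G 0 = 0) (h1 : G 1 = 1) (a b : ℤ) :
    G (a + 1) * G b - G (b + 1) * G a = (-1) ^ (b + 1) * G (a - b) := by
  have hs : ((-1 : ℚ) ^ (b + 1)) * (-1) ^ (b + 1) = 1 := by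
    rw [← mul_zpow]; norm_num
  have e := G_add h h0 h1 a (-b)
  rw [show -b - 1 = -(b + 1) by ring, G_neg h h0 h1 b, G_neg h h0 h1 (b + 1),
    ← sub_eq_add_neg, zpow_add₀ (by norm_num : (-1 : ℚ) ≠ 0) (b + 1) 1, zpow_one] at e
  rw [e]
  linear_combination -(G (a + 1) * G b - G (b + 1) * G a) * hs

lemma G_pos {k : ℚ} (hk : 0 < k) {G : ℤ → ℚ} (h : Rec k G) (h0 : G 0 = 0) (h1 : G 1 = 1)
    (a : ℤ) (ha : 1 ≤ a) : 0 < G a := by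
  have key : ∀ n : ℕ, 0 ≤ G n ∧ 0 < G (n + 1) := by
    intro n
    induction n with
    | zero => simp [h0, h1]
    | succ i ih =>
      push_cast
      refine ⟨ih.2.le, ?_⟩
      rw [h, add_sub_cancel_right]
      have := mul_pos hk ih.2
      linarith [ih.1]
  obtain ⟨m, rfl⟩ : ∃ m : ℕ, a = m + 1 := ⟨(a - 1).toNat, by omega⟩
  exact (key m).2

lemma G_ne {k : ℚ} (hk : 0 < k) {G : ℤ → ℚ} (h : Rec k G) (h0 : G 0 = 0) (h1 : G 1 = 1)
    (a : ℤ) (ha : a ≠ 0) : G a ≠ 0 := by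
  rcases lt_or_gt_of_ne ha with h' | h'
  · have := G_neg h h0 h1 (-a)
    rw [neg_neg] at this
    rw [this]
    exact mul_ne_zero (zpow_ne_zero _ (by norm_num)) (G_pos hk h h0 h1 _ (by omega)).ne'
  · exact (G_pos hk h h0 h1 _ (by omega)).ne'

/-- Lagrange interpolation of `∏_{l ≠ j} (X - x_l)` at the nodes `v`, evaluated at `x_i`. -/
lemma lagrange_sum (s : Finset ℕ) (x v : ℕ → ℚ) (hv : Set.InjOn v s)
    (i j : ℕ) (hj : j ∈ s) (hx : ∀ m ∈ s, v m - x i ≠ 0) :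
    ∑ m ∈ s, (∏ l ∈ s.erase j, (v m - x l)) / (∏ l ∈ s.erase m, (v m - v l)) / (v m - x i)
      = (∏ l ∈ s.erase j, (x l - x i)) / ∏ m ∈ s, (v m - x i) := by
  classical
  set P : Polynomial ℚ := ∏ l ∈ s.erase j, (Polynomial.X - Polynomial.C (x l)) with hP
  have hPe : ∀ t, P.eval t = ∏ l ∈ s.erase j, (t - x l) := by
    intro t; simp [hP, Polynomial.eval_prod]
  have hdeg : P.degree < #s := by
    rw [hP, Polynomial.degree_prod]
    simp only [Polynomial.degree_X_sub_C, sum_const, nsmul_eq_mul, mul_one]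
    exact_mod_cast card_erase_lt_of_mem hj
  have h1 := Lagrange.eq_interpolate hv hdeg
  have h2 := congrArg (Polynomial.eval (x i)) h1
  rw [Lagrange.eval_interpolate_not_at_node _ (fun m hm h => hx m hm (by rw [h]; ring)),
    Lagrange.eval_nodal] at h2
  simp only [hPe, Lagrange.nodalWeight] at h2
  have hn : ∏ m ∈ s, (x i - v m) ≠ 0 := prod_ne_zero_iff.2 fun m hm h => hx m hm (by linarith)
  have s1 : ∏ l ∈ s.erase j, (x l - x i) = (-1) ^ #(s.erase j) * ∏ l ∈ s.erase j, (x i - x l) := by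
    rw [← prod_const, ← prod_mul_distrib]; exact prod_congr rfl fun _ _ => by ring
  have s2 : ∏ m ∈ s, (v m - x i) = (-1) ^ #s * ∏ m ∈ s, (x i - v m) := by
    rw [← prod_const, ← prod_mul_distrib]; exact prod_congr rfl fun _ _ => by ring
  rw [s1, s2, h2, ← card_erase_add_one hj, pow_succ]
  have hs : ((-1 : ℚ) ^ #(s.erase j)) ≠ 0 := pow_ne_zero _ (by norm_num)
  rw [show ∀ p n e : ℚ, e * (n * p) / (e * -1 * n) = -p * ((e * n) / (e * n)) by
    intros; ring, div_self (mul_ne_zero hs hn), mul_one, ← sum_neg_distrib]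
  refine sum_congr rfl fun m hm => ?_
  rw [prod_inv_distrib, show x i - v m = -(v m - x i) by ring, inv_neg]
  ring

lemma prod_erase_split (n m : ℕ) (hm : m ≤ n) (f : ℕ → ℚ) :
    ∏ l ∈ (range (n + 1)).erase m, f l
      = (∏ i ∈ range m, f (m - 1 - i)) * ∏ i ∈ range (n - m), f (n - i) := by
  have e : (range (n + 1)).erase m = range m ∪ Ico (m + 1) (n + 1) := by
    ext a; simp only [mem_erase, mem_range, mem_union, mem_Ico]; omega
  rw [e, prod_union, prod_range_reflect, prod_Ico_eq_prod_range]
  · congr 1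
    rw [← prod_range_reflect, show n + 1 - (m + 1) = n - m by omega]
    refine prod_congr rfl fun i hi => ?_
    rw [mem_range] at hi
    congr 1; omega
  · rw [disjoint_left]; intro a; simp only [mem_range, mem_Ico]; omega

lemma sgn_sq (a : ℤ) : ((-1 : ℚ) ^ a) * (-1) ^ a = 1 := by
  rw [← mul_zpow]; norm_num

lemma sgn_eq (a b c : ℤ) (h : a = b + 2 * c) : ((-1 : ℚ) ^ a) = (-1) ^ b := by
  rw [h, zpow_add₀ (by norm_num), zpow_mul]; norm_num

/-- Signed product of differences. -/
lemma D_eq {k : ℚ} {G : ℤ → ℚ} (h : Rec k G) (h0 : G 0 = 0) (h1 : G 1 = 1)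
    (n m : ℕ) (hm : m ≤ n) :
    ∏ l ∈ (range (n + 1)).erase m, ((-1 : ℚ) ^ ((l : ℤ) + n) * G ((m : ℤ) - l))
      = (-1) ^ ((m.choose 2 : ℤ) + n * m) * (∏ i ∈ range m, G ((i : ℤ) + 1)) *
        ∏ i ∈ range (n - m), G ((i : ℤ) + 1) := by
  rw [prod_erase_split n m hm]
  have a1 : ∏ i ∈ range m, ((-1 : ℚ) ^ (((m - 1 - i : ℕ) : ℤ) + n) * G ((m : ℤ) - (m - 1 - i : ℕ)))
      = (-1) ^ ((m.choose 2 : ℤ) + n * m) * ∏ i ∈ range m, G ((i : ℤ) + 1) := by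
    have : ∀ i ∈ range m, ((-1 : ℚ) ^ (((m - 1 - i : ℕ) : ℤ) + n) * G ((m : ℤ) - (m - 1 - i : ℕ)))
        = (-1 : ℚ) ^ (((m - 1 - i : ℕ) + n : ℕ)) * G ((i : ℤ) + 1) := by
      intro i hi
      rw [mem_range] at hi
      rw [← zpow_natCast]
      congr 2 
      omega
    rw [prod_congr rfl this, prod_mul_distrib, prod_pow_eq_pow_sum]
    congr 1
    rw [← zpow_natCast]
    congr 1
    rw [sum_range_reflect (fun l => l + n) m, sum_add_distrib, sum_range_id, Nat.choose_two_right]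
    simp; ring
  have a2 : ∏ i ∈ range (n - m), ((-1 : ℚ) ^ (((n - i : ℕ) : ℤ) + n) * G ((m : ℤ) - (n - i : ℕ)))
      = ∏ i ∈ range (n - m), G ((i : ℤ) + 1) := by
    have : ∀ i ∈ range (n - m), ((-1 : ℚ) ^ (((n - i : ℕ) : ℤ) + n) * G ((m : ℤ) - (n - i : ℕ)))
        = (-1 : ℚ) ^ ((m : ℤ) + n + 1) * G (((n - m - 1 - i : ℕ) : ℤ) + 1) := by
      intro i hi
      rw [mem_range] at hi
      rw [show (m : ℤ) - (n - i : ℕ) = -(((n - m - 1 - i : ℕ) : ℤ) + 1) by omega, G_neg h h0 h1,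
        ← mul_assoc, ← zpow_add₀ (by norm_num)]
      congr 1
      apply sgn_eq _ _ ((n : ℤ) - i - m)
      omega
    rw [prod_congr rfl this, prod_mul_distrib, prod_range_reflect (fun i => G ((i : ℤ) + 1)),
      prod_const, card_range, ← zpow_natCast, ← zpow_mul]
    obtain ⟨d, rfl⟩ := Nat.exists_eq_add_of_le hm
    have he : Even ((d : ℤ) * (d + 1)) := Int.even_mul_succ_self d
    obtain ⟨c, hc⟩ := he
    rw [sgn_eq _ 0 (m * d + c) (by simp; linear_combination hc)]
    simp
  rw [a1, a2]

lemma fib_sum {k : ℚ} (hk : 0 < k) {G : ℤ → ℚ} (h : Rec k G) (h0 : G 0 = 0) (h1 : G 1 = 1)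
    (α : ℤ) (hα : 1 ≤ α) (n i j : ℕ) (hi : i ≤ n) (hj : j ≤ n) :
    ∑ m ∈ range (n + 1), (∏ l ∈ (range (n + 1)).erase j, G (α + l + m)) /
        (∏ l ∈ (range (n + 1)).erase m, ((-1 : ℚ) ^ ((l : ℤ) + n) * G ((m : ℤ) - l))) /
        G (α + i + m)
      = (-1) ^ (α * n) * (∏ l ∈ (range (n + 1)).erase j, ((-1 : ℚ) ^ ((l : ℤ) + n) * G ((i : ℤ) - l)))
        / ∏ m ∈ range (n + 1), G (α + i + m) := by
  set a : ℕ → ℚ := fun l => G (α + l + n + 1) with ha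
  set b : ℕ → ℚ := fun m => G ((m : ℤ) - n - 1) with hb
  set x : ℕ → ℚ := fun l => - G (α + l + n + 1 + 1) / a l with hx
  set v : ℕ → ℚ := fun m => G ((m : ℤ) - n - 1 - 1) / b m with hv
  have an : ∀ l, a l ≠ 0 := fun l => G_ne hk h h0 h1 _ (by omega)
  have bn : ∀ m ∈ range (n + 1), b m ≠ 0 := fun m hm => by
    rw [mem_range] at hm
    exact G_ne hk h h0 h1 _ (by omega)
  have c1 : ∀ l : ℕ, ∀ m ∈ range (n + 1), G (α + l + m) = a l * b m * (v m - x l) := by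
    intro l m hm
    have := G_add h h0 h1 (α + l + n + 1) ((m : ℤ) - n - 1)
    rw [show α + l + n + 1 + ((m : ℤ) - n - 1) = α + l + m by ring] at this
    have a1 := an l
    have b1 := bn m hm
    rw [this]
    simp only [hx, hv]
    field_simp
    simp only [ha, hb]
    ring
  have c2 : ∀ m ∈ range (n + 1), ∀ l ∈ range (n + 1),
      (-1 : ℚ) ^ ((l : ℤ) + n) * G ((m : ℤ) - l) = b m * b l * (v m - v l) := by
    intro m hm l hl
    have := G_docagne h h0 h1 ((m : ℤ) - n - 1 - 1) ((l : ℤ) - n - 1 - 1)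
    rw [sgn_eq _ ((l : ℤ) + n + 1) (-n - 1) (by ring), zpow_add₀ (by norm_num), zpow_one,
      show ((m : ℤ) - n - 1 - 1) - ((l : ℤ) - n - 1 - 1) = m - l by ring,
      sub_add_cancel, sub_add_cancel] at this
    have b1 := bn m hm
    have b2 := bn l hl
    rw [show (-1 : ℚ) ^ ((l : ℤ) + n) * G ((m : ℤ) - l)
      = -((-1 : ℚ) ^ ((l : ℤ) + n) * -1 * G ((m : ℤ) - l)) by ring, ← this]
    simp only [hv]
    field_simp
    simp only [hb]
    ring
  have c3 : ∀ l : ℕ,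
      (-1 : ℚ) ^ α * ((-1 : ℚ) ^ ((l : ℤ) + n) * G ((i : ℤ) - l)) = a i * a l * (x l - x i) := by
    intro l
    have := G_docagne h h0 h1 (α + i + n + 1) (α + l + n + 1)
    rw [sgn_eq _ (α + (l + n)) 1 (by ring_nf), zpow_add₀ (by norm_num), mul_assoc,
      show (α + i + n + 1) - (α + l + n + 1) = (i : ℤ) - l by ring] at this
    have b1 := an i
    have b2 := an l
    rw [← this]
    simp only [hx]
    field_simp
    simp only [ha]
    ring
  have hvi : Set.InjOn v (range (n + 1)) := by
    intro m hm l hl e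
    by_contra hne
    have := c2 m hm l hl
    rw [e, sub_self, mul_zero] at this
    exact mul_ne_zero (zpow_ne_zero _ (by norm_num)) (G_ne hk h h0 h1 _ (by omega)) this
  have hxv : ∀ m ∈ range (n + 1), v m - x i ≠ 0 := by
    intro m hm e
    have := c1 i m hm
    rw [e, mul_zero] at this
    exact G_ne hk h h0 h1 _ (by omega) this
  have hjm : j ∈ range (n + 1) := by simp; omega
  have him : i ∈ range (n + 1) := by simp; omega
  have key := lagrange_sum (range (n + 1)) x v hvi i j hjm hxv
  have card : ∀ m ∈ range (n + 1), #((range (n + 1)).erase m) = n := fun m hm => by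
    rw [card_erase_of_mem hm]; simp
  -- rewrite the right side
  have r1 : (-1) ^ (α * n) * (∏ l ∈ (range (n + 1)).erase j, ((-1 : ℚ) ^ ((l : ℤ) + n) * G ((i : ℤ) - l)))
      = a i ^ n * (∏ l ∈ (range (n + 1)).erase j, a l) * ∏ l ∈ (range (n + 1)).erase j, (x l - x i) := by
    rw [zpow_mul, zpow_natCast]
    nth_rewrite 1 [← card j hjm]
    nth_rewrite 4 [← card j hjm]
    rw [← prod_const, ← prod_const, ← prod_mul_distrib, ← prod_mul_distrib, ← prod_mul_distrib]
    exact prod_congr rfl fun l _ => c3 l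
  have r2 : ∏ m ∈ range (n + 1), G (α + i + m)
      = a i ^ (n + 1) * (∏ m ∈ range (n + 1), b m) * ∏ m ∈ range (n + 1), (v m - x i) := by
    rw [prod_congr rfl (c1 i), prod_mul_distrib, prod_mul_distrib, prod_const, card_range]
  have l1 : ∀ m ∈ range (n + 1), ∏ l ∈ (range (n + 1)).erase j, G (α + l + m)
      = (∏ l ∈ (range (n + 1)).erase j, a l) * b m ^ n * ∏ l ∈ (range (n + 1)).erase j, (v m - x l) := by
    intro m hm
    rw [prod_congr rfl fun l _ => c1 l m hm, prod_mul_distrib, prod_mul_distrib, prod_const,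
      card j hjm]
  have l2 : ∀ m ∈ range (n + 1),
      (∏ l ∈ (range (n + 1)).erase m, ((-1 : ℚ) ^ ((l : ℤ) + n) * G ((m : ℤ) - l))) * b m
      = b m ^ n * (∏ l ∈ range (n + 1), b l) * ∏ l ∈ (range (n + 1)).erase m, (v m - v l) := by
    intro m hm
    rw [prod_congr rfl fun l hl => c2 m hm l (mem_of_mem_erase hl), prod_mul_distrib,
      prod_mul_distrib, prod_const, card m hm, ← mul_prod_erase _ b hm]
    ring
  have hB : ∏ m ∈ range (n + 1), b m ≠ 0 := prod_ne_zero_iff.2 bn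
  have hai := an i
  have hV : ∏ m ∈ range (n + 1), (v m - x i) ≠ 0 := prod_ne_zero_iff.2 hxv
  rw [r1, r2]
  trans (∏ l ∈ (range (n + 1)).erase j, a l) / (a i * ∏ m ∈ range (n + 1), b m) *
      ((∏ l ∈ (range (n + 1)).erase j, (x l - x i)) / ∏ m ∈ range (n + 1), (v m - x i))
  · rw [← key, mul_sum]
    refine sum_congr rfl fun m hm => ?_
    have hbm := bn m hm
    have hw : ∏ l ∈ (range (n + 1)).erase m, (v m - v l) ≠ 0 := prod_ne_zero_iff.2 fun l hl e => by
      rw [mem_erase] at hl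
      exact hl.1 (hvi hl.2 hm (by linarith))
    have hxm := hxv m hm
    rw [l1 m hm, c1 i m hm, eq_div_of_mul_eq hbm (l2 m hm)]
    field_simp
  · field_simp
    ring

lemma entry {k : ℚ} {G : ℤ → ℚ} (h : Rec k G) (h0 : G 0 = 0) (h1 : G 1 = 1)
    (α : ℤ) (n j m : ℕ) (hj : j ≤ n) (hm : m ≤ n) :
    (-1 : ℚ) ^ ((α + j + m) * n - (j.choose 2 : ℤ) - (m.choose 2 : ℤ)) * G (α + j + m) *
      ((∏ i ∈ range (n - m), G (α + n + j - i)) / ∏ i ∈ range (n - m), G ((i : ℤ) + 1)) *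
      ((∏ i ∈ range (n - j), G (α + n + m - i)) / ∏ i ∈ range (n - j), G ((i : ℤ) + 1)) *
      ((∏ i ∈ range j, G (α + j + m - 1 - i)) / ∏ i ∈ range j, G ((i : ℤ) + 1)) *
      ((∏ i ∈ range m, G (α + j + m - 1 - i)) / ∏ i ∈ range m, G ((i : ℤ) + 1)) =
    (-1) ^ (α * n) * (∏ l ∈ range (n + 1), G (α + j + l)) /
      (∏ l ∈ (range (n + 1)).erase j, ((-1 : ℚ) ^ ((l : ℤ) + n) * G ((j : ℤ) - l))) *
      ((∏ l ∈ (range (n + 1)).erase j, G (α + l + m)) /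
        (∏ l ∈ (range (n + 1)).erase m, ((-1 : ℚ) ^ ((l : ℤ) + n) * G ((m : ℤ) - l)))) := by
  have hmm : m ∈ range (n + 1) := by simp; omega
  rw [D_eq h h0 h1 n m hm, D_eq h h0 h1 n j hj, ← mul_prod_erase _ _ hmm,
    prod_erase_split n m hm, prod_erase_split n j hj]
  have p1 : ∏ i ∈ range m, G (α + j + ((m - 1 - i : ℕ) : ℤ)) = ∏ i ∈ range m, G (α + j + m - 1 - i) :=
    prod_congr rfl fun i hi => by rw [mem_range] at hi; congr 1; omega
  have p2 : ∏ i ∈ range (n - m), G (α + j + ((n - i : ℕ) : ℤ)) = ∏ i ∈ range (n - m), G (α + n + j - i) :=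
    prod_congr rfl fun i hi => by rw [mem_range] at hi; congr 1; omega
  have p3 : ∏ i ∈ range j, G (α + ((j - 1 - i : ℕ) : ℤ) + m) = ∏ i ∈ range j, G (α + j + m - 1 - i) :=
    prod_congr rfl fun i hi => by rw [mem_range] at hi; congr 1; omega
  have p4 : ∏ i ∈ range (n - j), G (α + ((n - i : ℕ) : ℤ) + m) = ∏ i ∈ range (n - j), G (α + n + m - i) :=
    prod_congr rfl fun i hi => by rw [mem_range] at hi; congr 1; omega
  rw [p1, p2, p3, p4]
  have hs : (-1 : ℚ) ^ ((α + j + m) * n - (j.choose 2 : ℤ) - (m.choose 2 : ℤ))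
      = (-1) ^ (α * n) * ((-1) ^ ((j.choose 2 : ℤ) + n * j))⁻¹ * ((-1) ^ ((m.choose 2 : ℤ) + n * m))⁻¹ := by
    rw [← zpow_neg, ← zpow_neg, ← zpow_add₀ (by norm_num), ← zpow_add₀ (by norm_num)]
    apply sgn_eq _ _ (n * j + n * m)
    ring
  rw [hs]
  simp only [div_eq_mul_inv, mul_inv]
  ring

end HankelFib

theorem hankel_inverse_fib (k : ℤ) (hk : 1 ≤ k) (F : ℤ → ℤ)
    (hF0 : F 0 = 0) (hF1 : F 1 = 1)
    (hFrec : ∀ n : ℤ, F (n + 1) = k * F n + F (n - 1))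
    (α : ℤ) (hα : 1 ≤ α) (n : ℕ)
    (A : Matrix (Fin (n + 1)) (Fin (n + 1)) ℚ)
    (hA : ∀ j m : Fin (n + 1), A j m = (1 : ℚ) / (F (α + (j : ℕ) + (m : ℕ)) : ℚ)) :
    IsUnit A ∧ ∀ j m : Fin (n + 1),
      A⁻¹ j m =
        (-1 : ℚ) ^ ((α + (j : ℕ) + (m : ℕ)) * n - ((j : ℕ).choose 2 : ℤ)
            - ((m : ℕ).choose 2 : ℤ)) *
          (F (α + (j : ℕ) + (m : ℕ)) : ℚ) *
          fibin F (α + n + (j : ℕ)) (n - (m : ℕ)) *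
          fibin F (α + n + (m : ℕ)) (n - (j : ℕ)) *
          fibin F (α + (j : ℕ) + (m : ℕ) - 1) (j : ℕ) *
          fibin F (α + (j : ℕ) + (m : ℕ) - 1) (m : ℕ) := by
  have hk' : (0 : ℚ) < k := by exact_mod_cast (by omega : 0 < k)
  obtain ⟨G, hG⟩ : ∃ G : ℤ → ℚ, ∀ a, G a = (F a : ℚ) := ⟨fun a => F a, fun _ => rfl⟩
  have h : HankelFib.Rec (k : ℚ) G := fun a => by
    simp only [hG]; rw [hFrec]; push_cast; ring
  have h0 : G 0 = 0 := by simp [hG, hF0]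
  have h1 : G 1 = 1 := by simp [hG, hF1]
  simp only [fibin, ← hG] at hA ⊢
  set B : Matrix (Fin (n + 1)) (Fin (n + 1)) ℚ := fun j m =>
    (-1) ^ (α * n) * (∏ l ∈ Finset.range (n + 1), G (α + (j : ℕ) + l)) /
      (∏ l ∈ (Finset.range (n + 1)).erase j, ((-1 : ℚ) ^ ((l : ℤ) + n) * G (((j : ℕ) : ℤ) - l))) *
      ((∏ l ∈ (Finset.range (n + 1)).erase j, G (α + l + (m : ℕ))) /
        (∏ l ∈ (Finset.range (n + 1)).erase m, ((-1 : ℚ) ^ ((l : ℤ) + n) * G (((m : ℕ) : ℤ) - l))))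
    with hB
  have hBA : B * A = 1 := by
    ext j i
    have hj := j.is_lt
    have hi := i.is_lt
    have key := HankelFib.fib_sum hk' h h0 h1 α hα n i j (by omega) (by omega)
    rw [← Fin.sum_univ_eq_sum_range (fun m => (∏ l ∈ (Finset.range (n + 1)).erase j, G (α + l + m)) /
        (∏ l ∈ (Finset.range (n + 1)).erase m, ((-1 : ℚ) ^ ((l : ℤ) + n) * G ((m : ℤ) - l))) /
        G (α + (i : ℕ) + m))] at key
    rw [Matrix.mul_apply]
    have e : ∀ m : Fin (n + 1), B j m * A m i =
      (-1) ^ (α * n) * (∏ l ∈ Finset.range (n + 1), G (α + (j : ℕ) + l)) /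
      (∏ l ∈ (Finset.range (n + 1)).erase j, ((-1 : ℚ) ^ ((l : ℤ) + n) * G (((j : ℕ) : ℤ) - l))) *
      ((∏ l ∈ (Finset.range (n + 1)).erase j, G (α + l + (m : ℕ))) /
        (∏ l ∈ (Finset.range (n + 1)).erase m, ((-1 : ℚ) ^ ((l : ℤ) + n) * G (((m : ℕ) : ℤ) - l))) /
        G (α + (i : ℕ) + (m : ℕ))) := by
      intro m
      rw [hA m i, show α + ((m : ℕ) : ℤ) + (i : ℕ) = α + (i : ℕ) + (m : ℕ) by ring]
      simp only [hB]
      ring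
    rw [Finset.sum_congr rfl fun m _ => e m, ← Finset.mul_sum, key]
    by_cases hij : j = i
    · subst hij
      rw [Matrix.one_apply_eq]
      have n1 : (∏ l ∈ (Finset.range (n + 1)).erase j,
          ((-1 : ℚ) ^ ((l : ℤ) + n) * G (((j : ℕ) : ℤ) - l))) ≠ 0 :=
        Finset.prod_ne_zero_iff.2 fun l hl => by
          rw [Finset.mem_erase] at hl
          exact mul_ne_zero (zpow_ne_zero _ (by norm_num))
            (HankelFib.G_ne hk' h h0 h1 _ (by omega))
      have n2 : (∏ l ∈ Finset.range (n + 1), G (α + (j : ℕ) + l)) ≠ 0 :=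
        Finset.prod_ne_zero_iff.2 fun l hl => HankelFib.G_ne hk' h h0 h1 _ (by omega)
      have n3 := HankelFib.sgn_sq (α * n)
      generalize (-1 : ℚ) ^ (α * (n : ℤ)) = s at *
      field_simp
      linear_combination n3
    · rw [Matrix.one_apply_ne hij]
      have : (∏ l ∈ (Finset.range (n + 1)).erase j,
          ((-1 : ℚ) ^ ((l : ℤ) + n) * G (((i : ℕ) : ℤ) - l))) = 0 := by
        apply Finset.prod_eq_zero (i := (i : ℕ))
        · rw [Finset.mem_erase, Finset.mem_range]
          exact ⟨fun hh => hij (Fin.ext hh.symm), hi⟩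
        · rw [sub_self, h0, mul_zero]
      rw [this]; simp
  refine ⟨IsUnit.of_mul_eq_one_right B hBA, fun j m => ?_⟩
  rw [Matrix.inv_eq_left_inv hBA]
  have hj := j.is_lt
  have hm := m.is_lt
  exact (HankelFib.entry h h0 h1 α n j m (by omega) (by omega)).symm
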